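/- arXiv:1311.0522 — 4 statements merged into one kernel-verified Lean document; each statement's English description precedes it below -/
import Mathlib

section
/- Every hexagon graph of a finite simple cubic graph is bipartite. -/
open SimpleGraph

namespace Hex

variable {V : Type}

/-- A graph is cubic (3-regular) if every vertex has exactly 3 neighbors. -/
def IsCubic (G : SimpleGraph V) : Prop := ∀ v : V, (G.neighborSet v).ncard = 3

/-- A graph is bridgeless if none of its edges is a bridge. -/
def Bridgeless (G : SimpleGraph V) : Prop := ∀ e ∈ G.edgeSet, ¬G.IsBridge e

/-- A valid assignment of the indices `i_{v(u)} ∈ {0,1,2}`: with each neighbor `u` of `v`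
an index in `{0,1,2}` is associated, pairwise distinct for distinct neighbors. -/
def GoodIdx (G : SimpleGraph V) (idx : V → V → ZMod 6) : Prop :=
  (∀ v u : V, G.Adj v u → (idx v u).val < 3) ∧
  (∀ v u w : V, G.Adj v u → G.Adj v w → u ≠ w → idx v u ≠ idx v w)

/-- The pair of white edges `(e_{uv}, e'_{uv})` replacing the edge `uv` of `G`.
A vertex `v_i` belongs to the class `X` iff `i` is even, to `Y` iff `i` is odd. -/
def whitePairs (idx : V → V → ZMod 6) (u v : V) :
    Sym2 (V × ZMod 6) × Sym2 (V × ZMod 6) :=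
  if (idx u v).val % 2 = (idx v u).val % 2 then
    (s((u, idx u v), (v, idx v u + 3)), s((u, idx u v + 3), (v, idx v u)))
  else
    (s((u, idx u v), (v, idx v u)), s((u, idx u v + 3), (v, idx v u + 3)))

/-- The white edges of the hexagon graph. -/
def IsWhite (G : SimpleGraph V) (idx : V → V → ZMod 6) (e : Sym2 (V × ZMod 6)) : Prop :=
  ∃ u v : V, G.Adj u v ∧ (e = (whitePairs idx u v).1 ∨ e = (whitePairs idx u v).2)

/-- The red edges of the hexagon graph: the edges `v_i v_{i+3}`. -/
def IsRed (e : Sym2 (V × ZMod 6)) : Prop :=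
  ∃ (v : V) (i : ZMod 6), e = s((v, i), (v, i + 3))

/-- The blue edges of the hexagon graph: the edges `v_i v_{i+1}`. -/
def IsBlue (e : Sym2 (V × ZMod 6)) : Prop :=
  ∃ (v : V) (i : ZMod 6), e = s((v, i), (v, i + 1))

/-- The hexagon graph of `G` with respect to an index assignment `idx`: each vertex `v` of `G`
is replaced by a hexagon (a copy of `K_{3,3}` with vertex set `{v} × ZMod 6`, and edge set
`{v_i v_{i+1}} ∪ {v_i v_{i+3}}`), and each edge `uv` of `G` is replaced by the two white
edges `e_{uv}`, `e'_{uv}`. -/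
def hexagonGraph (G : SimpleGraph V) (idx : V → V → ZMod 6) : SimpleGraph (V × ZMod 6) :=
  SimpleGraph.fromRel fun p q =>
    (p.1 = q.1 ∧ (q.2 = p.2 + 1 ∨ q.2 = p.2 + 3)) ∨ IsWhite G idx s(p, q)

/-- A blue perfect matching of the hexagon graph: a perfect matching all of whose edges
are blue. -/
def IsBluePM (G : SimpleGraph V) (idx : V → V → ZMod 6)
    (M : (hexagonGraph G idx).Subgraph) : Prop :=
  M.IsPerfectMatching ∧ ∀ e ∈ M.edgeSet, IsBlue e

/-- The graph `M Δ W` on the vertices of the hexagon graph, whose edge set is the symmetric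
difference of the edge set of `M` and the set `W` of white edges. Its connected components
are the cycles of `M Δ W`. -/
def sdGraph (G : SimpleGraph V) (idx : V → V → ZMod 6)
    (M : (hexagonGraph G idx).Subgraph) : SimpleGraph (V × ZMod 6) :=
  SimpleGraph.fromEdgeSet (symmDiff M.edgeSet {e | IsWhite G idx e})

/-- The edge set of the subgraph of `G` induced by the cycle (connected component) `c`
of `M Δ W`: the edges `uv` of `G` such that `e_{uv}` or `e'_{uv}` belongs to `c`. -/
def inducedSet (G : SimpleGraph V) (idx : V → V → ZMod 6)
    (M : (hexagonGraph G idx).Subgraph)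
    (c : (sdGraph G idx M).ConnectedComponent) : Set (Sym2 V) :=
  {e | ∃ (u v : V) (i j : ZMod 6), (sdGraph G idx M).Adj (u, i) (v, j) ∧ u ≠ v ∧
    (sdGraph G idx M).connectedComponentMk (u, i) = c ∧ e = s(u, v)}

/-- A rotation system of `G`: for each vertex `v`, a cyclic permutation of the edges
incident with `v` (encoded on darts with tail `v`). -/
structure RotationSystem (G : SimpleGraph V) where
  σ : G.Dart ≃ G.Dart
  tail_eq : ∀ d : G.Dart, (σ d).toProd.1 = d.toProd.1
  cyclic : ∀ d d' : G.Dart, d.toProd.1 = d'.toProd.1 → ∃ n : ℕ, (⇑σ)^[n] d = d'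

/-- The face-traversal map of a rotation system: after traversing the dart `d = (v, w)`,
the next dart is obtained by applying the rotation at `w` to the edge of `d`. -/
def facePerm {G : SimpleGraph V} (ρ : RotationSystem G) : G.Dart → G.Dart :=
  fun d => ρ.σ d.symm

/-- The face boundaries of a rotation system, as edge sets of `G`. -/
def faceSets {G : SimpleGraph V} (ρ : RotationSystem G) : Set (Set (Sym2 V)) :=
  {S | ∃ d : G.Dart, S = {e | ∃ n : ℕ, ((facePerm ρ)^[n] d).edge = e}}

/-- The cyclic shift `0 ↦ 1 ↦ 2 ↦ 0` on the index set `{0,1,2} ⊂ ZMod 6`. -/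
def rot3 (a : ZMod 6) : ZMod 6 := if a = 2 then 0 else a + 1

/-- The cyclic shift `0 ↦ 2 ↦ 1 ↦ 0` on the index set `{0,1,2} ⊂ ZMod 6`. -/
def rot3inv (a : ZMod 6) : ZMod 6 := if a = 0 then 2 else a - 1

/-- An edge `e` belongs to the cycle (connected component) `c` of a graph `K`. -/
def edgeInComp {W : Type} (K : SimpleGraph W) (e : Sym2 W) (c : K.ConnectedComponent) :
    Prop :=
  e ∈ K.edgeSet ∧ ∀ x ∈ e, K.connectedComponentMk x = c

/-- A blue perfect matching `M` is safe if no cycle of `M Δ W` contains both end vertices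
of a red edge, i.e. no component of `M Δ W` contains both `(v, i)` and `(v, i + 3)`. -/
def SafePM (G : SimpleGraph V) (idx : V → V → ZMod 6)
    (M : (hexagonGraph G idx).Subgraph) : Prop :=
  ∀ (v : V) (i : ZMod 6), ¬(sdGraph G idx M).Reachable (v, i) (v, i + 3)

/-- A directed cycle double cover of `G`: a family of directed cycles (cycles traversed
in a chosen direction) such that every dart of `G` is traversed by exactly one member;
equivalently, every edge lies on exactly two members and they induce opposite
orientations on it. -/
def HasDCDC (G : SimpleGraph V) : Prop :=
  ∃ (ι : Type) (F : ι → Σ v : V, G.Walk v v),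
    (∀ i, (F i).2.IsCycle) ∧ ∀ d : G.Dart, ∃! i, d ∈ (F i).2.darts

/-- A brace: a simple connected bipartite graph on at least six vertices that has a
perfect matching and such that every pair of vertex-disjoint edges is contained in a
perfect matching. -/
def IsBrace {W : Type} [Fintype W] (H : SimpleGraph W) : Prop :=
  H.Connected ∧ H.Colorable 2 ∧ 6 ≤ Fintype.card W ∧
  (∃ M : H.Subgraph, M.IsPerfectMatching) ∧
  ∀ e₁ ∈ H.edgeSet, ∀ e₂ ∈ H.edgeSet, (∀ x ∈ e₁, x ∉ e₂) →
    ∃ M : H.Subgraph, M.IsPerfectMatching ∧ e₁ ∈ M.edgeSet ∧ e₂ ∈ M.edgeSet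

/-- The ladder `L_{2n}`: vertices `a_0, …, a_{n-1}, b_0, …, b_{n-1}`, with edges
`a_i a_{i+1}`, `b_i b_{i+1}` (indices mod `n`) and the rungs `a_i b_i`.
In particular `ladder 4` is the ladder `L_8` on 8 vertices. -/
def ladder (n : ℕ) : SimpleGraph (Fin 2 × ZMod n) :=
  SimpleGraph.fromRel fun p q => (p.1 = q.1 ∧ q.2 = p.2 + 1) ∨ (p.1 ≠ q.1 ∧ p.2 = q.2)

/-- The expansion of a vertex `x` to a path `x¹ v x²`, relative to the part `N1` of a
partition `(N1, N(x) \ N1)` of the neighborhood of `x`: `x` is deleted, the new path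
`x¹ v x²` is added (here `v := Sum.inl x`, `x¹ := Sum.inr 0`, `x² := Sum.inr 1`), every
vertex of `N1` is joined to `x¹` and every other neighbor of `x` is joined to `x²`. -/
def expansion {α : Type} (H : SimpleGraph α) (x : α) (N1 : Set α) :
    SimpleGraph (α ⊕ Fin 2) :=
  SimpleGraph.fromRel fun p q =>
    match p, q with
    | Sum.inl a, Sum.inl b => H.Adj a b ∧ a ≠ x ∧ b ≠ x
    | Sum.inr i, Sum.inl a =>
        (a = x ∧ (i = 0 ∨ i = 1)) ∨ (i = 0 ∧ a ∈ N1 ∧ H.Adj x a) ∨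
        (i = 1 ∧ a ∉ N1 ∧ H.Adj x a)
    | _, _ => False

/-- `H'` is obtained from `H` by a type-1 augmentation: one new edge is added so that the
result is bipartite (stated up to isomorphism). -/
def IsType1Aug {α β : Type} (H : SimpleGraph α) (H' : SimpleGraph β) : Prop :=
  ∃ x y : α, x ≠ y ∧ ¬H.Adj x y ∧
    (SimpleGraph.fromEdgeSet (insert s(x, y) H.edgeSet)).Colorable 2 ∧
    Nonempty (H' ≃g SimpleGraph.fromEdgeSet (insert s(x, y) H.edgeSet))

/-- `H'` is obtained from `H` by a type-2 augmentation: a vertex `x` of degree at least 4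
is expanded to `x¹ v x²` (with both parts of the neighborhood partition of size at least 2)
and a new edge `v w` is added, where `w` is a vertex in the same partition class as `x`
(stated up to isomorphism). -/
def IsType2Aug {α β : Type} (H : SimpleGraph α) (H' : SimpleGraph β) : Prop :=
  ∃ (x w : α) (N1 : Set α),
    4 ≤ (H.neighborSet x).ncard ∧ N1 ⊆ H.neighborSet x ∧ 2 ≤ N1.ncard ∧
    2 ≤ (H.neighborSet x \ N1).ncard ∧ w ≠ x ∧
    (∃ C : H.Coloring (Fin 2), C w = C x) ∧
    Nonempty (H' ≃g SimpleGraph.fromEdgeSet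
      (insert s(Sum.inl x, Sum.inl w) (expansion H x N1).edgeSet))

/-- A bundled graph (a graph together with its vertex type). -/
structure BundledGraph : Type 1 where
  carrier : Type
  graph : SimpleGraph carrier

/-- A simple augmentation: a type-1 or a type-2 augmentation. -/
def IsSimpleAug (A B : BundledGraph) : Prop :=
  IsType1Aug A.graph B.graph ∨ IsType2Aug A.graph B.graph

/-- The set of vertices of the square `s_v` that are covered by an edge of `S`
(for `S` the projection of an edge or path, these are the vertices of its
supporting edge in `s_v`). -/
def sqSupp (v : V) (S : Set (Sym2 (V × ZMod 4))) : Set (V × ZMod 4) :=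
  {p | p.1 = v ∧ ∃ e ∈ S, p ∈ e}

/-- An `M`-square graph of `G`: each vertex `v` of `G` is replaced by a square `s_v`
(a copy of `K_{2,2}` on `{v} × ZMod 4`, with edge set `{v_j v_{j+1}}`), and each edge `uv`
of `G` is replaced by its projection `pr u v`, a set of two edges forming, together with a
supporting edge in each of `s_u`, `s_v`, a copy of `K_{2,2}`; whenever `uv ∈ M` and `w, z`
are the other two neighbors of `v`, the supporting edges of `pr w v` and `pr z v` in `s_v`
are vertex-disjoint. -/
structure SquareGraph (G : SimpleGraph V) (M : Set (Sym2 V)) where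
  Q : SimpleGraph (V × ZMod 4)
  pr : V → V → Set (Sym2 (V × ZMod 4))
  bip : Q.Colorable 2
  intra : ∀ (v : V) (j k : ZMod 4), Q.Adj (v, j) (v, k) ↔ (k = j + 1 ∨ j = k + 1)
  pr_symm : ∀ u v : V, pr u v = pr v u
  pr_shape : ∀ u v : V, G.Adj u v → ∃ j k : ZMod 4,
    pr u v = {s((u, j), (v, k)), s((u, j + 1), (v, k + 1))} ∨
    pr u v = {s((u, j), (v, k)), s((u, j + 1), (v, k + 3))}
  inter : ∀ (u v : V) (j k : ZMod 4), u ≠ v →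
    (Q.Adj (u, j) (v, k) ↔ G.Adj u v ∧ s((u, j), (v, k)) ∈ pr u v)
  matched : ∀ v u w z : V, G.Adj v u → G.Adj v w → G.Adj v z → u ≠ w → u ≠ z → w ≠ z →
    s(u, v) ∈ M → Disjoint (sqSupp v (pr w v)) (sqSupp v (pr z v))

/-- An odd ear decomposition of `G`: a sequence of subgraphs `G_0, …, G_l` where `G_0` is
an even cycle, `G_l = G`, and each `G_i` is obtained from `G_{i-1}` by attaching an odd
path (ear) whose ends lie in `G_{i-1}` and which is otherwise disjoint from `G_{i-1}`. -/
structure OddEarDecomp (G : SimpleGraph V) where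
  l : ℕ
  Gs : Fin (l + 1) → G.Subgraph
  base : ∃ (v : V) (c : G.Walk v v), c.IsCycle ∧ Even c.length ∧ Gs 0 = c.toSubgraph
  top : Gs (Fin.last l) = ⊤
  ear : ∀ i : Fin l, ∃ (a b : V) (p : G.Walk a b),
    p.IsPath ∧ Odd p.length ∧
    a ∈ (Gs i.castSucc).verts ∧ b ∈ (Gs i.castSucc).verts ∧
    (∀ w ∈ p.support, w ≠ a → w ≠ b → w ∉ (Gs i.castSucc).verts) ∧
    (∀ e ∈ p.edges, e ∉ (Gs i.castSucc).edgeSet) ∧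
    Gs i.succ = Gs i.castSucc ⊔ p.toSubgraph

/-- A perfect matching `M` of `G` is absolute in an odd ear decomposition if its
restriction to each `G_i` is a perfect matching of `G_i`. -/
def AbsoluteIn {G : SimpleGraph V} (M : G.Subgraph) (D : OddEarDecomp G) : Prop :=
  ∀ i : Fin (D.l + 1), ∀ v ∈ (D.Gs i).verts, ∃! w : V, M.Adj v w ∧ (D.Gs i).Adj v w

/-- The set `V_3(K)` of vertices of degree 3 in the subgraph `K`. -/
def deg3 {G : SimpleGraph V} (K : G.Subgraph) : Set V :=
  {v | (K.neighborSet v).ncard = 3}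

/-- A member of `P(K)`: a path of `K` whose end vertices have degree 3 in `K` and all of
whose internal vertices have degree 2 in `K`. -/
def IsEarPath {G : SimpleGraph V} (K : G.Subgraph) {u v : V} (p : G.Walk u v) : Prop :=
  p.IsPath ∧ 0 < p.length ∧ (∀ e ∈ p.edges, e ∈ K.edgeSet) ∧
  u ∈ deg3 K ∧ v ∈ deg3 K ∧
  ∀ w ∈ p.support, w ≠ u → w ≠ v → (K.neighborSet w).ncard = 2

/-- A `(K, M)`-ear square graph (for `K` one of the graphs `G_i` of an ear decomposition):
each vertex `v` of degree 3 in `K` is replaced by a square `s_v` on `{v} × ZMod 4` (all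
other vertices of the ambient type are isolated), and each path `p(u,v) ∈ P(K)` is
replaced by its projected path `pr p`, a set of two edges forming, together with a
supporting edge in each of `s_u`, `s_v`, a copy of `K_{2,2}`; projected paths of distinct
paths are disjoint; and for every `v ∈ V_3(K)`, the two paths at `v` other than the
matching-path of `v` have vertex-disjoint supporting edges in `s_v`. -/
structure EarSquareGraph (G : SimpleGraph V) (K : G.Subgraph) (M : Set (Sym2 V)) where
  Q : SimpleGraph (V × ZMod 4)
  pr : ∀ {u v : V}, G.Walk u v → Set (Sym2 (V × ZMod 4))
  bip : Q.Colorable 2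
  isolated : ∀ (v : V) (j : ZMod 4) (q : V × ZMod 4), v ∉ deg3 K → ¬Q.Adj (v, j) q
  intra : ∀ v ∈ deg3 K, ∀ j k : ZMod 4, Q.Adj (v, j) (v, k) ↔ (k = j + 1 ∨ j = k + 1)
  pr_symm : ∀ {u v : V} (p : G.Walk u v), pr p.reverse = pr p
  pr_shape : ∀ {u v : V} (p : G.Walk u v), IsEarPath K p → ∃ j k : ZMod 4,
    pr p = {s((u, j), (v, k)), s((u, j + 1), (v, k + 1))} ∨
    pr p = {s((u, j), (v, k)), s((u, j + 1), (v, k + 3))}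
  pr_disjoint : ∀ {u v u' v' : V} (p : G.Walk u v) (q : G.Walk u' v'),
    IsEarPath K p → IsEarPath K q →
    (⟨u, v, p⟩ : Σ a b : V, G.Walk a b) ≠ ⟨u', v', q⟩ →
    (⟨u, v, p⟩ : Σ a b : V, G.Walk a b) ≠ ⟨v', u', q.reverse⟩ →
    Disjoint (pr p) (pr q)
  inter : ∀ (u v : V) (j k : ZMod 4), u ≠ v →
    (Q.Adj (u, j) (v, k) ↔ ∃ p : G.Walk u v, IsEarPath K p ∧ s((u, j), (v, k)) ∈ pr p)
  matched : ∀ (v y z : V) (q : G.Walk v y) (r : G.Walk v z),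
    IsEarPath K q → IsEarPath K r → q.getVert 1 ≠ r.getVert 1 →
    (∀ w : V, s(v, w) ∈ M → q.getVert 1 ≠ w ∧ r.getVert 1 ≠ w) →
    Disjoint (sqSupp v (pr q)) (sqSupp v (pr r))

/-- The endpoints of a white edge have indices of opposite parity. -/
lemma IsWhite.val_mod_two_ne {G : SimpleGraph V} {idx : V → V → ZMod 6} {p q : V × ZMod 6}
    (h : IsWhite G idx s(p, q)) : p.2.val % 2 ≠ q.2.val % 2 := by
  have same : ∀ a b : ZMod 6, a.val % 2 = b.val % 2 →
      a.val % 2 ≠ (b + 3).val % 2 ∧ (a + 3).val % 2 ≠ b.val % 2 := by decide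
  have diff : ∀ a b : ZMod 6, a.val % 2 ≠ b.val % 2 →
      (a + 3).val % 2 ≠ (b + 3).val % 2 := by decide
  obtain ⟨u, v, -, h⟩ := h
  unfold whitePairs at h
  split_ifs at h with huv <;> simp only [Sym2.eq_iff] at h <;>
    rcases h with (⟨rfl, rfl⟩ | ⟨rfl, rfl⟩) | (⟨rfl, rfl⟩ | ⟨rfl, rfl⟩)
  · exact (same _ _ huv).1
  · exact (same _ _ huv).1.symm
  · exact (same _ _ huv).2
  · exact (same _ _ huv).2.symm
  · exact huv
  · exact Ne.symm huv
  · exact diff _ _ huv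
  · exact (diff _ _ huv).symm

/-- Adjacent vertices of a hexagon graph have indices of opposite parity. -/
lemma val_mod_two_ne_of_adj {G : SimpleGraph V} {idx : V → V → ZMod 6} {p q : V × ZMod 6}
    (h : (hexagonGraph G idx).Adj p q) : p.2.val % 2 ≠ q.2.val % 2 := by
  have inner : ∀ a b : ZMod 6, b = a + 1 ∨ b = a + 3 → a.val % 2 ≠ b.val % 2 := by decide
  rw [hexagonGraph, SimpleGraph.fromRel_adj] at h
  obtain ⟨-, (⟨-, h⟩ | h) | (⟨-, h⟩ | h)⟩ := h
  · exact inner _ _ h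
  · exact h.val_mod_two_ne
  · exact (inner _ _ h).symm
  · exact h.val_mod_two_ne.symm

/-- Every hexagon graph of a finite simple cubic graph is bipartite. -/
theorem stmt0 {V : Type} [Fintype V] [DecidableEq V] (G : SimpleGraph V)
    (hG : IsCubic G) (idx : V → V → ZMod 6) (hidx : GoodIdx G idx) :
    (hexagonGraph G idx).Colorable 2 := by
  exact ⟨Coloring.mk (fun p => (⟨p.2.val % 2, Nat.mod_lt _ two_pos⟩ : Fin 2))
    fun h heq => val_mod_two_ne_of_adj h (congrArg Fin.val heq)⟩

end Hex
end

section
/- If H and H' are two hexagon graphs of the same finite simple cubic graph G (arising from possibly different choices of the index assignments i_{v(u)}), then H and H' are isomorphic as graphs. -/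
open SimpleGraph

namespace Hex

variable {V : Type}

/-- The red edge `{v_i, v_{i+3}}` containing `v_i`, as a residue modulo 3. -/
def redClass : ZMod 6 → ZMod 3 := ZMod.castHom (by decide : 3 ∣ 6) (ZMod 3)

/-- The class (`X` for `0`, `Y` for `1`) containing `v_i`, as a residue modulo 2. -/
def partClass : ZMod 6 → ZMod 2 := ZMod.castHom (by decide : 2 ∣ 6) (ZMod 2)

theorem bijective_redClass_partClass :
    Function.Bijective fun i : ZMod 6 => (redClass i, partClass i) := by
  decide

theorem partClass_ne_iff (i j : ZMod 6) :
    partClass i ≠ partClass j ↔ (j = i + 1 ∨ j = i + 3) ∨ (i = j + 1 ∨ i = j + 3) := by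
  revert i j
  decide

theorem whitePairs_index_iff (a b i j : ZMod 6) :
    (if a.val % 2 = b.val % 2 then (i = a ∧ j = b + 3) ∨ (i = a + 3 ∧ j = b)
      else (i = a ∧ j = b) ∨ (i = a + 3 ∧ j = b + 3)) ↔
      partClass i ≠ partClass j ∧ redClass i = redClass a ∧ redClass j = redClass b := by
  revert a b i j
  decide +kernel

theorem isWhite_iff (G : SimpleGraph V) (idx : V → V → ZMod 6) (u v : V) (i j : ZMod 6) :
    IsWhite G idx s((u, i), (v, j)) ↔
      G.Adj u v ∧ partClass i ≠ partClass j ∧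
        redClass i = redClass (idx u v) ∧ redClass j = redClass (idx v u) := by
  have key : ∀ (x y : V) (k l : ZMod 6),
      ((s((x, k), (y, l)) = (whitePairs idx x y).1 ∨
        s((x, k), (y, l)) = (whitePairs idx x y).2) ∧ x ≠ y) ↔
      (partClass k ≠ partClass l ∧
        redClass k = redClass (idx x y) ∧ redClass l = redClass (idx y x)) ∧ x ≠ y := by
    intro x y k l
    refine and_congr_left fun hxy => ?_
    rw [← whitePairs_index_iff]
    unfold whitePairs
    split_ifs <;> simp [hxy]
  constructor
  · rintro ⟨x, y, hxy, h⟩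
    have hends : (x = u ∧ y = v) ∨ (x = v ∧ y = u) := by
      unfold whitePairs at h
      split_ifs at h <;> simp only [Sym2.eq_iff, Prod.mk.injEq] at h <;> tauto
    rcases hends with ⟨rfl, rfl⟩ | ⟨rfl, rfl⟩
    · exact ⟨hxy, ((key _ _ _ _).1 ⟨h, hxy.ne⟩).1⟩
    · rw [Sym2.eq_swap] at h
      obtain ⟨⟨h₁, h₂, h₃⟩, -⟩ := (key _ _ _ _).1 ⟨h, hxy.ne⟩
      exact ⟨hxy.symm, h₁.symm, h₃, h₂⟩
  · rintro ⟨huv, h⟩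
    exact ⟨u, v, huv, ((key _ _ _ _).2 ⟨h, huv.ne⟩).1⟩

theorem hexagonGraph_adj (G : SimpleGraph V) (idx : V → V → ZMod 6) (u v : V) (i j : ZMod 6) :
    (hexagonGraph G idx).Adj (u, i) (v, j) ↔ partClass i ≠ partClass j ∧
      (u = v ∨ G.Adj u v ∧ redClass i = redClass (idx u v) ∧
        redClass j = redClass (idx v u)) := by
  have hne : partClass i ≠ partClass j → i ≠ j := fun h hij => h (hij ▸ rfl)
  have hpart := partClass_ne_iff i j
  simp only [hexagonGraph, SimpleGraph.fromRel_adj, Sym2.eq_swap (a := (v, j)), isWhite_iff,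
    ne_eq, Prod.mk.injEq, eq_comm (a := v)] at *
  tauto

theorem redClass_injective_of_val_lt {a b : ZMod 6} (ha : a.val < 3) (hb : b.val < 3)
    (h : redClass a = redClass b) : a = b := by
  revert a b
  decide

theorem GoodIdx.bijective_redClass {G : SimpleGraph V} (hG : IsCubic G)
    {idx : V → V → ZMod 6} (hidx : GoodIdx G idx) (v : V) :
    Function.Bijective fun u : G.neighborSet v => redClass (idx v u) := by
  have : Finite (G.neighborSet v) := Set.finite_of_ncard_ne_zero (by rw [hG v]; decide)
  refine (Nat.bijective_iff_injective_and_card _).2 ⟨fun u w huw => ?_, ?_⟩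
  · by_contra hne
    exact hidx.2 v u w u.2 w.2 (fun h => hne (Subtype.ext h))
      (redClass_injective_of_val_lt (hidx.1 v u u.2) (hidx.1 v w w.2) huw)
  · rw [Nat.card_coe_set_eq, hG v, Nat.card_zmod]

theorem exists_perm_redClass {G : SimpleGraph V} (hG : IsCubic G) {idx idx' : V → V → ZMod 6}
    (hidx : GoodIdx G idx) (hidx' : GoodIdx G idx') (v : V) :
    ∃ τ : Equiv.Perm (ZMod 6), (∀ i, partClass (τ i) = partClass i) ∧
      ∀ u, G.Adj v u → ∀ i,
        redClass (τ i) = redClass (idx' v u) ↔ redClass i = redClass (idx v u) := by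
  let f := Equiv.ofBijective _ (hidx.bijective_redClass hG v)
  let f' := Equiv.ofBijective _ (hidx'.bijective_redClass hG v)
  let c := Equiv.ofBijective _ bijective_redClass_partClass
  let σ : Equiv.Perm (ZMod 3) := f.symm.trans f'
  let τ : Equiv.Perm (ZMod 6) := (c.trans (σ.prodCongr (Equiv.refl _))).trans c.symm
  have hτ : ∀ i, c (τ i) = (σ (redClass i), partClass i) := fun i => c.apply_symm_apply _
  refine ⟨τ, fun i => congrArg Prod.snd (hτ i), fun u hu i => ?_⟩
  have hred : redClass (τ i) = σ (redClass i) := congrArg Prod.fst (hτ i)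
  have hσ : σ (redClass (idx v u)) = redClass (idx' v u) :=
    congrArg f' (f.symm_apply_apply ⟨u, hu⟩)
  rw [hred, ← hσ, σ.apply_eq_iff_eq]

/-- any two hexagon graphs of the same cubic graph `G` (arising from possibly
different index assignments) are isomorphic. -/
theorem stmt5 {V : Type} [Fintype V] [DecidableEq V] (G : SimpleGraph V)
    (hG : IsCubic G) (idx idx' : V → V → ZMod 6)
    (hidx : GoodIdx G idx) (hidx' : GoodIdx G idx') :
    Nonempty (hexagonGraph G idx ≃g hexagonGraph G idx') := by
  choose τ hpart hred using exists_perm_redClass hG hidx hidx'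
  refine ⟨⟨Equiv.prodShear (Equiv.refl V) τ, ?_⟩⟩
  rintro ⟨u, i⟩ ⟨v, j⟩
  simp only [Equiv.prodShear_apply, Equiv.refl_apply, hexagonGraph_adj, hpart]
  refine and_congr_right fun _ => or_congr_right <| and_congr_right fun huv => ?_
  rw [hred u v huv, hred v u huv.symm]

end Hex
end

section
/- Let G be a finite simple cubic graph, H a hexagon graph of G, and W the set of white edges of H. There is a bijection f from the set of blue perfect matchings of H to the set of rotation systems of G such that for every blue perfect matching M of H, the set of subgraphs of G induced by the cycles of the symmetric difference M Δ W equals the set of face boundaries of the rotation system f(M). Explicitly, for a vertex v of G with neighbors u, w, z and indices i_{v(u)} = 0, i_{v(w)} = 1, i_{v(z)} = 2, one has f(M)_v = (uv wv zv) if M ∩ E(h_v) = {v_0 v_1, v_2 v_3, v_4 v_5}, and f(M)_v = (uv zv wv) if M ∩ E(h_v) = {v_1 v_2, v_3 v_4, v_5 v_0}. -/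
open SimpleGraph

namespace Hex

variable {V : Type}

/-- The odd one of the two opposite hexagon positions `r`, `r + 3`. -/
def oddLift (r : ZMod 6) : ZMod 6 := if r.val % 2 = 1 then r else r + 3

/-- The even one of the two opposite hexagon positions `r`, `r + 3`. -/
def evenLift (r : ZMod 6) : ZMod 6 := if r.val % 2 = 1 then r + 3 else r

/-- The cyclic shift of `{0,1,2}` in the direction given by a sign. -/
def signedRot (b : Bool) (r : ZMod 6) : ZMod 6 := if b then rot3 r else rot3inv r

/-- The partner of a hexagon position in the blue perfect matching of the hexagon that
contains `{0, 1}` (sign `true`) or does not (sign `false`). -/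
def bluePartner (b : Bool) (p : ZMod 6) : ZMod 6 :=
  if p.val % 2 = 0 then (if b then p + 1 else p - 1) else (if b then p - 1 else p + 1)

theorem bluePartner_involutive : ∀ b p, bluePartner b (bluePartner b p) = p := by decide

theorem bluePartner_eq : ∀ b p, bluePartner b p = p + 1 ∨ p = bluePartner b p + 1 := by decide

theorem bluePartner_zero : ∀ b, bluePartner b 0 = 1 ↔ b = true := by decide

theorem bluePartner_evenLift : ∀ (b : Bool) (r : ZMod 6), r.val < 3 →
    bluePartner b (evenLift r) = oddLift (signedRot b r) := by decide

theorem signedRot_val_lt : ∀ (b : Bool) (r : ZMod 6), r.val < 3 →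
    (signedRot b r).val < 3 := by decide

theorem signedRot_injOn : ∀ (b : Bool) (r t : ZMod 6), r.val < 3 → t.val < 3 →
    signedRot b r = signedRot b t → r = t := by decide

theorem exists_eq_signedRot : ∀ (b : Bool) (r t : ZMod 6), r.val < 3 → t.val < 3 →
    t = r ∨ t = signedRot b r ∨ t = signedRot b (signedRot b r) := by decide

theorem signedRot_zero_inj : ∀ b c : Bool, signedRot b 0 = signedRot c 0 → b = c := by decide

theorem oddLift_injOn : ∀ r t : ZMod 6, r.val < 3 → t.val < 3 →
    oddLift r = oddLift t → r = t := by decide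

theorem evenLift_injOn : ∀ r t : ZMod 6, r.val < 3 → t.val < 3 →
    evenLift r = evenLift t → r = t := by decide

theorem oddLift_ne_evenLift : ∀ r t : ZMod 6, oddLift r ≠ evenLift t := by decide

theorem exists_lift_eq : ∀ p : ZMod 6, ∃ r : ZMod 6, r.val < 3 ∧
    (p = oddLift r ∨ p = evenLift r) := by decide

theorem eq_signedRot_of_fixedPointFree : ∀ x y z : ZMod 6, x.val < 3 → y.val < 3 → z.val < 3 →
    x ≠ y → x ≠ z → y ≠ z → x ≠ 0 → y ≠ 1 → z ≠ 2 →
    ∃ b, x = signedRot b 0 ∧ y = signedRot b 1 ∧ z = signedRot b 2 := by decide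

theorem val_lt_three_cases : ∀ r : ZMod 6, r.val < 3 → r = 0 ∨ r = 1 ∨ r = 2 := by decide

section Darts

variable {G : SimpleGraph V}

/-- The index associated with the head of a dart at its tail. -/
def dartIdx (idx : V → V → ZMod 6) (d : G.Dart) : ZMod 6 := idx d.fst d.snd

/-- The odd end of the white edge of a dart, in the hexagon of its tail. -/
def oddEnd (idx : V → V → ZMod 6) (d : G.Dart) : V × ZMod 6 :=
  (d.fst, oddLift (idx d.fst d.snd))

/-- The even end of the white edge of a dart, in the hexagon of its head. -/
def evenEnd (idx : V → V → ZMod 6) (d : G.Dart) : V × ZMod 6 :=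
  (d.snd, evenLift (idx d.snd d.fst))

variable {idx : V → V → ZMod 6}

theorem dartIdx_val_lt (hidx : GoodIdx G idx) (d : G.Dart) : (dartIdx idx d).val < 3 :=
  hidx.1 _ _ d.adj

theorem dart_eq_of_dartIdx (hidx : GoodIdx G idx) {d e : G.Dart} (h : d.fst = e.fst)
    (hi : dartIdx idx d = dartIdx idx e) : d = e := by
  obtain ⟨⟨v, u⟩, hd⟩ := d
  obtain ⟨⟨w, z⟩, he⟩ := e
  simp only [dartIdx] at h hi
  subst h
  by_contra hne
  exact hidx.2 v u z hd he (fun huz => hne (by subst huz; rfl)) hi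

theorem exists_dart (hG : IsCubic G) (hidx : GoodIdx G idx) (v : V) {r : ZMod 6}
    (hr : r.val < 3) : ∃ d : G.Dart, d.fst = v ∧ dartIdx idx d = r := by
  have hinj : Set.InjOn (idx v) (G.neighborSet v) := fun u hu w hw h => by
    by_contra hne
    exact hidx.2 v u w hu hw hne h
  have himg : idx v '' G.neighborSet v = {r : ZMod 6 | r.val < 3} := by
    refine Set.eq_of_subset_of_ncard_le ?_ ?_
    · rintro _ ⟨u, hu, rfl⟩
      exact hidx.1 v u hu
    · rw [hinj.ncard_image, hG v, Set.ncard_eq_toFinset_card']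
      decide
  obtain ⟨u, hu, rfl⟩ : r ∈ idx v '' G.neighborSet v := himg ▸ hr
  exact ⟨⟨(v, u), hu⟩, rfl, rfl⟩

theorem oddEnd_injective (hidx : GoodIdx G idx) :
    Function.Injective (oddEnd (G := G) idx) := fun d e h => by
  simp only [oddEnd, Prod.mk.injEq] at h
  exact dart_eq_of_dartIdx hidx h.1
    (oddLift_injOn _ _ (dartIdx_val_lt hidx d) (dartIdx_val_lt hidx e) h.2)

theorem evenEnd_injective (hidx : GoodIdx G idx) :
    Function.Injective (evenEnd (G := G) idx) := fun d e h => by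
  simp only [evenEnd, Prod.mk.injEq] at h
  exact SimpleGraph.Dart.symm_involutive.injective (dart_eq_of_dartIdx hidx h.1
    (evenLift_injOn _ _ (dartIdx_val_lt hidx d.symm) (dartIdx_val_lt hidx e.symm) h.2))

theorem oddEnd_ne_evenEnd (d e : G.Dart) : oddEnd idx d ≠ evenEnd idx e := fun h =>
  oddLift_ne_evenLift _ _ (congrArg Prod.snd h)

theorem exists_end_eq (hG : IsCubic G) (hidx : GoodIdx G idx) (x : V × ZMod 6) :
    ∃ d : G.Dart, x = oddEnd idx d ∨ x = evenEnd idx d := by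
  obtain ⟨v, p⟩ := x
  obtain ⟨r, hr, hp⟩ := exists_lift_eq p
  obtain ⟨d, rfl, rfl⟩ := exists_dart hG hidx v hr
  rcases hp with rfl | rfl
  · exact ⟨d, Or.inl rfl⟩
  · exact ⟨d.symm, Or.inr rfl⟩

theorem isWhite_iff_s6 {e : Sym2 (V × ZMod 6)} :
    IsWhite G idx e ↔ ∃ d : G.Dart, e = s(oddEnd idx d, evenEnd idx d) := by
  constructor
  · rintro ⟨u, v, huv, he⟩
    have hu := Nat.mod_two_eq_zero_or_one (idx u v).val
    have hv := Nat.mod_two_eq_zero_or_one (idx v u).val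
    rcases hu with hu | hu <;> rcases hv with hv | hv <;>
      simp only [whitePairs, hu, hv, reduceIte, zero_ne_one, one_ne_zero] at he <;>
      rcases he with rfl | rfl
    all_goals first
      | refine ⟨⟨(u, v), huv⟩, ?_⟩
        simp [oddEnd, evenEnd, oddLift, evenLift, hu, hv]
        done
      | refine ⟨⟨(v, u), huv.symm⟩, ?_⟩
        simp [oddEnd, evenEnd, oddLift, evenLift, hu, hv]
  · rintro ⟨d, rfl⟩
    refine ⟨d.fst, d.snd, d.adj, ?_⟩
    have hu := Nat.mod_two_eq_zero_or_one (idx d.fst d.snd).val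
    have hv := Nat.mod_two_eq_zero_or_one (idx d.snd d.fst).val
    rcases hu with hu | hu <;> rcases hv with hv | hv <;>
      simp [whitePairs, oddEnd, evenEnd, oddLift, evenLift, hu, hv]

end Darts

section Rotations

variable {G : SimpleGraph V} {idx : V → V → ZMod 6}

theorem rotationSystem_ext {ρ τ : RotationSystem G} (h : ∀ d, ρ.σ d = τ.σ d) : ρ = τ := by
  cases ρ
  cases τ
  congr
  exact Equiv.ext h

/-- The rotation system `ρ` turns at each vertex `v` in the direction given by `s v`. -/
def HasSigns (idx : V → V → ZMod 6) (s : V → Bool) (ρ : RotationSystem G) : Prop :=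
  ∀ d : G.Dart, dartIdx idx (ρ.σ d) = signedRot (s d.fst) (dartIdx idx d)

theorem HasSigns.unique (hidx : GoodIdx G idx) {s : V → Bool} {ρ τ : RotationSystem G}
    (hρ : HasSigns idx s ρ) (hτ : HasSigns idx s τ) : ρ = τ :=
  rotationSystem_ext fun d => dart_eq_of_dartIdx hidx ((ρ.tail_eq d).trans (τ.tail_eq d).symm)
    ((hρ d).trans (hτ d).symm)

theorem HasSigns.signs_unique (hG : IsCubic G) (hidx : GoodIdx G idx) {s t : V → Bool}
    {ρ : RotationSystem G} (hs : HasSigns idx s ρ) (ht : HasSigns idx t ρ) : s = t := by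
  funext v
  obtain ⟨d, rfl, hd⟩ := exists_dart hG hidx v (r := 0) (by decide)
  have h := (hs d).symm.trans (ht d)
  rw [hd] at h
  exact signedRot_zero_inj _ _ h

theorem exists_hasSigns [Finite V] (hG : IsCubic G) (hidx : GoodIdx G idx) (s : V → Bool) :
    ∃ ρ : RotationSystem G, HasSigns idx s ρ := by
  have hT : ∀ d : G.Dart, ∃ e : G.Dart,
      e.fst = d.fst ∧ dartIdx idx e = signedRot (s d.fst) (dartIdx idx d) := fun d =>
    exists_dart hG hidx d.fst (signedRot_val_lt _ _ (dartIdx_val_lt hidx d))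
  choose T hT₁ hT₂ using hT
  have : Finite G.Dart := Finite.of_injective _ SimpleGraph.Dart.toProd_injective
  have hinj : Function.Injective T := fun d e h => by
    have h₁ : d.fst = e.fst := by rw [← hT₁ d, h, hT₁ e]
    refine dart_eq_of_dartIdx hidx h₁ (signedRot_injOn (s d.fst) _ _ (dartIdx_val_lt hidx d)
      (dartIdx_val_lt hidx e) ?_)
    rw [← hT₂ d, h, hT₂ e, h₁]
  refine ⟨⟨Equiv.ofBijective T (Finite.injective_iff_bijective.mp hinj), hT₁, fun d e h => ?_⟩,
    hT₂⟩
  rcases exists_eq_signedRot (s d.fst) _ _ (dartIdx_val_lt hidx d) (dartIdx_val_lt hidx e) with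
    h' | h' | h'
  · exact ⟨0, dart_eq_of_dartIdx hidx h h'.symm⟩
  · refine ⟨1, dart_eq_of_dartIdx hidx ((hT₁ d).trans h) ?_⟩
    rw [h', ← hT₂ d]
    rfl
  · refine ⟨2, dart_eq_of_dartIdx hidx ((hT₁ _).trans ((hT₁ d).trans h)) ?_⟩
    rw [h', ← hT₂ d, ← hT₁ d, ← hT₂ (T d)]
    rfl

theorem exists_signs (hG : IsCubic G) (hidx : GoodIdx G idx) (ρ : RotationSystem G) :
    ∃ s : V → Bool, HasSigns idx s ρ := by
  have key : ∀ v, ∃ b : Bool, ∀ d : G.Dart, d.fst = v →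
      dartIdx idx (ρ.σ d) = signedRot b (dartIdx idx d) := by
    intro v
    obtain ⟨d₀, h₀, i₀⟩ := exists_dart hG hidx v (r := 0) (by decide)
    obtain ⟨d₁, h₁, i₁⟩ := exists_dart hG hidx v (r := 1) (by decide)
    obtain ⟨d₂, h₂, i₂⟩ := exists_dart hG hidx v (r := 2) (by decide)
    have hne : ∀ d e : G.Dart, d.fst = v → e.fst = v → dartIdx idx d ≠ dartIdx idx e →
        dartIdx idx (ρ.σ d) ≠ dartIdx idx (ρ.σ e) := by
      intro d e hd he hde h
      have := dart_eq_of_dartIdx hidx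
        ((ρ.tail_eq d).trans ((hd.trans he.symm).trans (ρ.tail_eq e).symm)) h
      exact hde (by rw [ρ.σ.injective this])
    have hfix : ∀ d e : G.Dart, d.fst = v → e.fst = v → dartIdx idx d ≠ dartIdx idx e →
        dartIdx idx (ρ.σ d) ≠ dartIdx idx d := by
      intro d e hd he hde h
      have hσ : ρ.σ d = d := dart_eq_of_dartIdx hidx (ρ.tail_eq d) h
      obtain ⟨n, hn⟩ := ρ.cyclic d e (hd.trans he.symm)
      rw [Function.iterate_fixed hσ] at hn
      exact hde (by rw [hn])
    obtain ⟨b, e₀, e₁, e₂⟩ := eq_signedRot_of_fixedPointFree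
      (dartIdx idx (ρ.σ d₀)) (dartIdx idx (ρ.σ d₁)) (dartIdx idx (ρ.σ d₂))
      (dartIdx_val_lt hidx _) (dartIdx_val_lt hidx _) (dartIdx_val_lt hidx _)
      (hne _ _ h₀ h₁ (by rw [i₀, i₁]; decide)) (hne _ _ h₀ h₂ (by rw [i₀, i₂]; decide))
      (hne _ _ h₁ h₂ (by rw [i₁, i₂]; decide))
      (i₀ ▸ hfix d₀ d₁ h₀ h₁ (by rw [i₀, i₁]; decide))
      (i₁ ▸ hfix d₁ d₀ h₁ h₀ (by rw [i₀, i₁]; decide))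
      (i₂ ▸ hfix d₂ d₀ h₂ h₀ (by rw [i₀, i₂]; decide))
    refine ⟨b, fun d hd => ?_⟩
    rcases val_lt_three_cases _ (dartIdx_val_lt hidx d) with h | h | h
    · rw [dart_eq_of_dartIdx hidx (hd.trans h₀.symm) (h.trans i₀.symm), e₀, i₀]
    · rw [dart_eq_of_dartIdx hidx (hd.trans h₁.symm) (h.trans i₁.symm), e₁, i₁]
    · rw [dart_eq_of_dartIdx hidx (hd.trans h₂.symm) (h.trans i₂.symm), e₂, i₂]
  choose s hs using key
  exact ⟨s, fun d => hs _ d rfl⟩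

theorem HasSigns.bluePartner_evenEnd (hidx : GoodIdx G idx) {s : V → Bool}
    {ρ : RotationSystem G} (hs : HasSigns idx s ρ) (d : G.Dart) :
    (d.snd, bluePartner (s d.snd) (evenLift (idx d.snd d.fst))) = oddEnd idx (facePerm ρ d) := by
  have h₁ := ρ.tail_eq d.symm
  have h₂ := hs d.symm
  rw [bluePartner_evenLift _ _ (hidx.1 _ _ d.adj.symm)]
  refine Prod.ext h₁.symm (congrArg oddLift ?_)
  exact h₂.symm

theorem facePerm_injective (ρ : RotationSystem G) : Function.Injective (facePerm ρ) :=
  ρ.σ.injective.comp SimpleGraph.Dart.symm_involutive.injective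

end Rotations

section Matchings

variable {G : SimpleGraph V} {idx : V → V → ZMod 6}

/-- The blue perfect matching with prescribed signs. -/
def signedMatching (G : SimpleGraph V) (idx : V → V → ZMod 6) (s : V → Bool) :
    (hexagonGraph G idx).Subgraph where
  verts := Set.univ
  Adj x y := y = (x.1, bluePartner (s x.1) x.2)
  adj_sub := by
    rintro ⟨v, p⟩ _ rfl
    have h : ∀ b p, p ≠ bluePartner b p := by decide
    rw [hexagonGraph, SimpleGraph.fromRel_adj]
    refine ⟨fun hp => h _ _ (congrArg Prod.snd hp), ?_⟩
    rcases bluePartner_eq (s v) p with hp | hp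
    · exact Or.inl (Or.inl ⟨rfl, Or.inl hp⟩)
    · exact Or.inr (Or.inl ⟨rfl, Or.inl hp⟩)
  edge_vert _ := Set.mem_univ _
  symm := ⟨by
    rintro ⟨v, p⟩ _ rfl
    simp [bluePartner_involutive]⟩

theorem fst_eq_of_signedMatching_adj {s : V → Bool} {x y : V × ZMod 6}
    (h : (signedMatching G idx s).Adj x y) : y.1 = x.1 := by
  obtain rfl : y = (x.1, bluePartner (s x.1) x.2) := h
  rfl

theorem isBluePM_signedMatching (s : V → Bool) : IsBluePM G idx (signedMatching G idx s) := by
  refine ⟨SimpleGraph.Subgraph.isPerfectMatching_iff.mpr fun x => ⟨_, rfl, fun y hy => hy⟩, ?_⟩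
  intro e
  induction e with
  | h x y =>
    obtain ⟨v, p⟩ := x
    intro h
    obtain rfl : y = (v, bluePartner (s v) p) := h
    rcases bluePartner_eq (s v) p with hp | hp
    · exact ⟨v, p, by rw [← hp]⟩
    · exact ⟨v, bluePartner (s v) p, by rw [← hp, Sym2.eq_swap]⟩

theorem mem_edgeSet_signedMatching (s : V → Bool) (v : V) :
    s((v, (0 : ZMod 6)), (v, (1 : ZMod 6))) ∈ (signedMatching G idx s).edgeSet ↔ s v = true := by
  rw [SimpleGraph.Subgraph.mem_edgeSet, ← bluePartner_zero]
  simp [signedMatching, eq_comm]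

theorem signedMatching_injective : Function.Injective (signedMatching G idx) := fun s t h => by
  funext v
  rw [Bool.eq_iff_iff, ← mem_edgeSet_signedMatching (G := G) (idx := idx), h,
    mem_edgeSet_signedMatching]

theorem exists_eq_signedMatching {M : (hexagonGraph G idx).Subgraph} (hM : IsBluePM G idx M) :
    ∃ s, M = signedMatching G idx s := by
  classical
  obtain ⟨hpm, hblue⟩ := hM
  rw [SimpleGraph.Subgraph.isPerfectMatching_iff] at hpm
  have hnbr : ∀ v i y, M.Adj (v, i) y → y = (v, i + 1) ∨ y = (v, i - 1) := by
    intro v i y h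
    obtain ⟨w, j, hj⟩ := hblue s((v, i), y) h
    rw [Sym2.eq_iff] at hj
    rcases hj with ⟨h₁, rfl⟩ | ⟨h₁, rfl⟩
    · obtain ⟨rfl, rfl⟩ := Prod.mk.inj h₁
      exact Or.inl rfl
    · obtain ⟨rfl, rfl⟩ := Prod.mk.inj h₁
      exact Or.inr (by simp)
  have halt : ∀ v i, M.Adj (v, i + 1) (v, i + 1 + 1) ↔ ¬ M.Adj (v, i) (v, i + 1) := by
    intro v i
    obtain ⟨y, hy, huniq⟩ := hpm (v, i + 1)
    constructor
    · intro h₁ h₂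
      have := (huniq _ h₁).trans (huniq _ h₂.symm).symm
      have h' : ∀ i : ZMod 6, i + 1 + 1 ≠ i := by decide
      exact h' i (congrArg Prod.snd this)
    · intro h
      rcases hnbr _ _ _ hy with rfl | rfl
      · exact hy
      · rw [add_sub_cancel_right] at hy
        exact absurd hy.symm h
  refine ⟨fun v => decide (M.Adj (v, 0) (v, 1)), ?_⟩
  have hadj : ∀ v p, M.Adj (v, p) (v, bluePartner (decide (M.Adj (v, 0) (v, 1))) p) := by
    intro v
    have a₀ := halt v 0
    have a₁ := halt v 1
    have a₂ := halt v 2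
    have a₃ := halt v 3
    have a₄ := halt v 4
    have a₅ := halt v 5
    rw [show (0 : ZMod 6) + 1 = 1 from rfl] at a₀
    rw [show (1 : ZMod 6) + 1 = 2 from rfl] at a₀ a₁
    rw [show (2 : ZMod 6) + 1 = 3 from rfl] at a₁ a₂
    rw [show (3 : ZMod 6) + 1 = 4 from rfl] at a₂ a₃
    rw [show (4 : ZMod 6) + 1 = 5 from rfl] at a₃ a₄
    rw [show (5 : ZMod 6) + 1 = 0 from rfl] at a₄ a₅
    rw [show (0 : ZMod 6) + 1 = 1 from rfl] at a₅
    have hp : ∀ p : ZMod 6, p = 0 ∨ p = 1 ∨ p = 2 ∨ p = 3 ∨ p = 4 ∨ p = 5 := by decide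
    intro p
    by_cases h : M.Adj (v, 0) (v, 1)
    · rw [decide_eq_true h]
      rcases hp p with rfl | rfl | rfl | rfl | rfl | rfl
      · exact h
      · exact h.symm
      · exact a₁.mpr fun h' => a₀.mp h' h
      · exact (a₁.mpr fun h' => a₀.mp h' h).symm
      · exact (a₃.mpr fun h' => a₂.mp h' (a₁.mpr fun h' => a₀.mp h' h))
      · exact (a₃.mpr fun h' => a₂.mp h' (a₁.mpr fun h' => a₀.mp h' h)).symm
    · rw [decide_eq_false h]
      have b₁ := a₀.mpr h
      have b₃ := a₂.mpr fun h' => a₁.mp h' b₁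
      have b₅ := a₄.mpr fun h' => a₃.mp h' b₃
      rcases hp p with rfl | rfl | rfl | rfl | rfl | rfl
      · exact b₅.symm
      · exact b₁
      · exact b₁.symm
      · exact b₃
      · exact b₃.symm
      · exact b₅
  refine SimpleGraph.Subgraph.ext ?_ ?_
  · exact Set.eq_univ_of_forall fun x => (hadj x.1 x.2).fst_mem
  · funext x y
    refine propext ⟨fun h => (hpm x).unique h (hadj x.1 x.2), ?_⟩
    rintro rfl
    exact hadj x.1 x.2

end Matchings

section Faces

variable {G : SimpleGraph V} {idx : V → V → ZMod 6} {s : V → Bool}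
  {ρ : RotationSystem G}

theorem signedMatching_adj_iff (hG : IsCubic G) (hidx : GoodIdx G idx) (hs : HasSigns idx s ρ)
    {x y : V × ZMod 6} : (signedMatching G idx s).Adj x y ↔
      ∃ d : G.Dart, s(x, y) = s(evenEnd idx d, oddEnd idx (facePerm ρ d)) := by
  have hd : ∀ d, (signedMatching G idx s).Adj (evenEnd idx d) (oddEnd idx (facePerm ρ d)) :=
    fun d => (hs.bluePartner_evenEnd hidx d).symm
  constructor
  · intro h
    have hsurj : ∀ e : G.Dart, ∃ d, facePerm ρ d = e := fun e =>
      ⟨(ρ.σ.symm e).symm, by simp [facePerm]⟩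
    obtain ⟨d, rfl | rfl⟩ := exists_end_eq hG hidx x
    · obtain ⟨d, rfl⟩ := hsurj d
      refine ⟨d, ?_⟩
      rw [Sym2.eq_swap, show y = evenEnd idx d from Eq.trans h (Eq.symm (hd d).symm)]
    · exact ⟨d, by rw [show y = oddEnd idx (facePerm ρ d) from Eq.trans h (Eq.symm (hd d))]⟩
  · rintro ⟨d, h⟩
    rw [Sym2.eq_iff] at h
    rcases h with ⟨rfl, rfl⟩ | ⟨rfl, rfl⟩
    · exact hd d
    · exact (hd d).symm

theorem sdGraph_adj_iff (hG : IsCubic G) (hidx : GoodIdx G idx) (hs : HasSigns idx s ρ)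
    {x y : V × ZMod 6} : (sdGraph G idx (signedMatching G idx s)).Adj x y ↔
      (∃ d : G.Dart, s(x, y) = s(oddEnd idx d, evenEnd idx d)) ∨
      ∃ d : G.Dart, s(x, y) = s(evenEnd idx d, oddEnd idx (facePerm ρ d)) := by
  rw [← signedMatching_adj_iff hG hidx hs, ← isWhite_iff_s6, sdGraph, SimpleGraph.fromEdgeSet_adj,
    Set.mem_symmDiff, SimpleGraph.Subgraph.mem_edgeSet, Set.mem_ofPred_eq]
  have hdisj : (signedMatching G idx s).Adj x y → ¬ IsWhite G idx s(x, y) := by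
    intro h hw
    obtain ⟨d, hd⟩ := isWhite_iff_s6.mp hw
    have hxy : y.1 = x.1 := fst_eq_of_signedMatching_adj h
    rw [Sym2.eq_iff] at hd
    rcases hd with ⟨rfl, rfl⟩ | ⟨rfl, rfl⟩
    · exact d.adj.ne hxy.symm
    · exact d.adj.ne hxy
  have hne : IsWhite G idx s(x, y) → x ≠ y := by
    rintro h rfl
    obtain ⟨d, hd⟩ := isWhite_iff_s6.mp h
    rw [Sym2.eq_iff] at hd
    rcases hd with ⟨h₁, h₂⟩ | ⟨h₁, h₂⟩
    · exact oddEnd_ne_evenEnd d d (h₁.symm.trans h₂)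
    · exact oddEnd_ne_evenEnd d d (h₂.symm.trans h₁)
  have hne' : (signedMatching G idx s).Adj x y → x ≠ y := fun h => h.ne
  tauto

theorem reachable_oddEnd_iterate (hG : IsCubic G) (hidx : GoodIdx G idx)
    (hs : HasSigns idx s ρ) (d : G.Dart) (n : ℕ) :
    (sdGraph G idx (signedMatching G idx s)).Reachable (oddEnd idx d)
      (oddEnd idx ((facePerm ρ)^[n] d)) := by
  induction n with
  | zero => exact .refl _
  | succ n ih =>
    rw [Function.iterate_succ_apply']
    exact (ih.trans (SimpleGraph.Adj.reachable
      ((sdGraph_adj_iff hG hidx hs).mpr (Or.inl ⟨_, rfl⟩)))).trans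
      (SimpleGraph.Adj.reachable ((sdGraph_adj_iff hG hidx hs).mpr (Or.inr ⟨_, rfl⟩)))

theorem exists_iterate_of_reachable [Finite V] (hG : IsCubic G) (hidx : GoodIdx G idx)
    (hs : HasSigns idx s ρ) {d : G.Dart} {x : V × ZMod 6}
    (h : (sdGraph G idx (signedMatching G idx s)).Reachable (oddEnd idx d) x) :
    ∃ n : ℕ, x = oddEnd idx ((facePerm ρ)^[n] d) ∨ x = evenEnd idx ((facePerm ρ)^[n] d) := by
  have : Finite G.Dart := Finite.of_injective _ SimpleGraph.Dart.toProd_injective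
  rw [SimpleGraph.reachable_iff_reflTransGen] at h
  induction h with
  | refl => exact ⟨0, Or.inl rfl⟩
  | tail _ hadj ih =>
    obtain ⟨n, rfl | rfl⟩ := ih <;>
      rcases (sdGraph_adj_iff hG hidx hs).mp hadj with ⟨e, he⟩ | ⟨e, he⟩ <;>
      rw [Sym2.eq_iff] at he <;> rcases he with ⟨h₁, rfl⟩ | ⟨h₁, rfl⟩
    · exact ⟨n, Or.inr (by rw [oddEnd_injective hidx h₁])⟩
    · exact absurd h₁ (oddEnd_ne_evenEnd _ _)
    · exact absurd h₁ (oddEnd_ne_evenEnd _ _)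
    · have h₂ := oddEnd_injective hidx h₁
      obtain ⟨N, hN, hper⟩ := (facePerm_injective ρ).mem_periodicPts e
      obtain ⟨k, rfl⟩ : ∃ k, N = k + 1 := ⟨N - 1, by omega⟩
      refine ⟨k + n, Or.inr (congrArg _ ?_)⟩
      rw [Function.iterate_add_apply, h₂, ← Function.iterate_succ_apply]
      exact hper.symm
    · exact absurd h₁.symm (oddEnd_ne_evenEnd _ _)
    · exact ⟨n, Or.inl (by rw [evenEnd_injective hidx h₁])⟩
    · refine ⟨n + 1, Or.inl ?_⟩
      rw [Function.iterate_succ_apply', evenEnd_injective hidx h₁]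
    · exact absurd h₁.symm (oddEnd_ne_evenEnd _ _)

theorem inducedSet_oddEnd [Finite V] (hG : IsCubic G) (hidx : GoodIdx G idx)
    (hs : HasSigns idx s ρ) (d : G.Dart) :
    inducedSet G idx (signedMatching G idx s)
      ((sdGraph G idx (signedMatching G idx s)).connectedComponentMk (oddEnd idx d)) =
      {e | ∃ n : ℕ, ((facePerm ρ)^[n] d).edge = e} := by
  ext e
  constructor
  · rintro ⟨u, v, i, j, hadj, huv, hc, rfl⟩
    obtain ⟨n, hn⟩ := exists_iterate_of_reachable hG hidx hs
      (SimpleGraph.ConnectedComponent.exact hc).symm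
    refine ⟨n, ?_⟩
    rcases (sdGraph_adj_iff hG hidx hs).mp hadj with ⟨e, he⟩ | h
    · have hedge : s(u, v) = e.edge := congrArg (Sym2.map Prod.fst) he
      rw [hedge]
      rw [Sym2.eq_iff] at he
      rcases he with ⟨h₁, -⟩ | ⟨h₁, -⟩ <;> rw [h₁] at hn <;> rcases hn with hn | hn
      · rw [oddEnd_injective hidx hn]
      · exact absurd hn (oddEnd_ne_evenEnd _ _)
      · exact absurd hn.symm (oddEnd_ne_evenEnd _ _)
      · rw [evenEnd_injective hidx hn]
    · rw [← signedMatching_adj_iff hG hidx hs] at h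
      exact absurd (fst_eq_of_signedMatching_adj h).symm huv
  · rintro ⟨n, rfl⟩
    exact ⟨_, _, _, _, (sdGraph_adj_iff hG hidx hs).mpr (Or.inl ⟨(facePerm ρ)^[n] d, rfl⟩),
      ((facePerm ρ)^[n] d).adj.ne,
      SimpleGraph.ConnectedComponent.sound (reachable_oddEnd_iterate hG hidx hs d n).symm, rfl⟩

theorem range_inducedSet [Finite V] (hG : IsCubic G) (hidx : GoodIdx G idx)
    (hs : HasSigns idx s ρ) :
    Set.range (inducedSet G idx (signedMatching G idx s)) = faceSets ρ := by
  ext S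
  constructor
  · rintro ⟨c, rfl⟩
    induction c using SimpleGraph.ConnectedComponent.ind with
    | h x =>
      obtain ⟨d, rfl | rfl⟩ := exists_end_eq hG hidx x
      · exact ⟨d, inducedSet_oddEnd hG hidx hs d⟩
      · refine ⟨d, ?_⟩
        rw [← inducedSet_oddEnd hG hidx hs d]
        refine congrArg _ (SimpleGraph.ConnectedComponent.sound (SimpleGraph.Adj.reachable ?_))
        exact (sdGraph_adj_iff hG hidx hs).mpr (Or.inl ⟨d, Sym2.eq_swap⟩)
  · rintro ⟨d, rfl⟩
    exact ⟨_, inducedSet_oddEnd hG hidx hs d⟩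

theorem HasSigns.snd_eq_iff (hidx : GoodIdx G idx) (hs : HasSigns idx s ρ) {v u w : V}
    (hu : G.Adj v u) (hw : G.Adj v w) :
    (ρ.σ ⟨(v, u), hu⟩).toProd.2 = w ↔ idx v w = signedRot (s v) (idx v u) := by
  have h₁ : (ρ.σ ⟨(v, u), hu⟩).fst = v := ρ.tail_eq _
  have h₂ : dartIdx idx (ρ.σ ⟨(v, u), hu⟩) = signedRot (s v) (idx v u) := hs _
  constructor
  · rintro rfl
    rw [← h₂, dartIdx, h₁]
  · intro h
    exact congrArg (fun d : G.Dart => d.snd)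
      (dart_eq_of_dartIdx hidx (e := ⟨(v, w), hw⟩) h₁ (h₂.trans h.symm))

end Faces

/-- there is a bijection `f` from the blue perfect matchings of the hexagon
graph to the rotation systems of `G` such that the set of subgraphs of `G` induced by the
cycles of `M Δ W` equals the set of face boundaries of `f(M)`; explicitly, the rotation at
`v` advances indices cyclically by `+1` on `{0,1,2}` if `M ∩ E(h_v) = {v_0v_1, v_2v_3,
v_4v_5}` (i.e. `v_0v_1 ∈ M`), and by `-1` otherwise. -/
theorem stmt6 {V : Type} [Fintype V] [DecidableEq V] (G : SimpleGraph V)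
    (hG : IsCubic G) (idx : V → V → ZMod 6) (hidx : GoodIdx G idx) :
    ∃ f : {M : (hexagonGraph G idx).Subgraph // IsBluePM G idx M} → RotationSystem G,
      Function.Bijective f ∧
      (∀ M, Set.range (inducedSet G idx M.val) = faceSets (f M)) ∧
      (∀ M (v u w : V) (hu : G.Adj v u), G.Adj v w →
        (s((v, (0 : ZMod 6)), (v, (1 : ZMod 6))) ∈ M.val.edgeSet →
          ((((f M).σ ⟨(v, u), hu⟩).toProd.2 = w) ↔ idx v w = rot3 (idx v u))) ∧
        (s((v, (0 : ZMod 6)), (v, (1 : ZMod 6))) ∉ M.val.edgeSet →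
          ((((f M).σ ⟨(v, u), hu⟩).toProd.2 = w) ↔ idx v w = rot3inv (idx v u)))) := by
  choose rot hrot using exists_hasSigns hG hidx
  have hrotBij : Function.Bijective rot := by
    refine ⟨fun s t h => ?_, fun ρ => ?_⟩
    · exact (hrot s).signs_unique hG hidx (h ▸ hrot t)
    · obtain ⟨s, hs⟩ := exists_signs hG hidx ρ
      exact ⟨s, (hrot s).unique hidx hs⟩
  let g : (V → Bool) → {M : (hexagonGraph G idx).Subgraph // IsBluePM G idx M} :=
    fun s => ⟨signedMatching G idx s, isBluePM_signedMatching s⟩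
  have hg : Function.Bijective g := by
    refine ⟨fun s t h => signedMatching_injective (congrArg Subtype.val h), fun M => ?_⟩
    obtain ⟨s, hs⟩ := exists_eq_signedMatching M.2
    exact ⟨s, Subtype.ext hs.symm⟩
  let E := Equiv.ofBijective g hg
  have hE : ∀ s, E.symm (g s) = s := E.symm_apply_apply
  refine ⟨rot ∘ E.symm, hrotBij.comp E.symm.bijective, fun M => ?_, fun M v u w hu hw => ?_⟩
  · obtain ⟨s, rfl⟩ := hg.2 M
    rw [Function.comp_apply, hE]
    exact range_inducedSet hG hidx (hrot s)
  · obtain ⟨s, rfl⟩ := hg.2 M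
    rw [Function.comp_apply, hE, (hrot s).snd_eq_iff hidx hu hw, mem_edgeSet_signedMatching]
    constructor <;> intro h <;> simp [signedRot, h]

end Hex
end

section
/- Let G be a finite simple cubic graph, H a hexagon graph of G, W the set of white edges of H, and M a blue perfect matching of H. Then some cycle of the symmetric difference M Δ W contains both end vertices of some red edge of H if and only if there is an edge uv of G such that e_{uv} and e'_{uv} belong to the same cycle of M Δ W, which holds if and only if some edge of G belongs to exactly one of the subgraphs of G induced by the cycles of M Δ W. -/
open SimpleGraph

namespace Hex

variable {V : Type}

theorem whitePairs_eq (idx : V → V → ZMod 6) (u v : V) :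
    ∃ j : ZMod 6, whitePairs idx u v =
      (s((u, idx u v), (v, j)), s((u, idx u v + 3), (v, j + 3))) := by
  unfold whitePairs
  split_ifs
  · refine ⟨idx v u + 3, ?_⟩
    rw [add_assoc, show (3 + 3 : ZMod 6) = 0 by decide, add_zero]
  · exact ⟨idx v u, rfl⟩

theorem whitePairs_comm (idx : V → V → ZMod 6) (u v : V) :
    whitePairs idx v u = whitePairs idx u v ∨
      whitePairs idx v u = (whitePairs idx u v).swap := by
  unfold whitePairs
  by_cases h : (idx u v).val % 2 = (idx v u).val % 2
  · right
    simp [h, Sym2.eq_swap]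
  · left
    simp [h, Ne.symm h, Sym2.eq_swap]

theorem not_isBlue_of_ne {u v : V} (h : u ≠ v) (i j : ZMod 6) :
    ¬ IsBlue s((u, i), (v, j)) := by
  rintro ⟨w, k, hw⟩
  rcases Sym2.eq_iff.1 hw with ⟨h₁, h₂⟩ | ⟨h₁, h₂⟩ <;>
    exact h ((congrArg Prod.fst h₁).trans (congrArg Prod.fst h₂).symm)

section

variable {G : SimpleGraph V} {idx : V → V → ZMod 6} {M : (hexagonGraph G idx).Subgraph}

theorem sdGraph_adj_of_isWhite (hM : IsBluePM G idx M) {u v : V} (huv : u ≠ v) {i j : ZMod 6}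
    (h : IsWhite G idx s((u, i), (v, j))) : (sdGraph G idx M).Adj (u, i) (v, j) := by
  rw [sdGraph, fromEdgeSet_adj]
  exact ⟨Or.inr ⟨h, fun hmem => not_isBlue_of_ne huv i j (hM.2 _ hmem)⟩,
    fun he => huv (congrArg Prod.fst he)⟩

theorem isWhite_of_sdGraph_adj (hM : IsBluePM G idx M) {u v : V} (huv : u ≠ v) {i j : ZMod 6}
    (h : (sdGraph G idx M).Adj (u, i) (v, j)) : IsWhite G idx s((u, i), (v, j)) := by
  rw [sdGraph, fromEdgeSet_adj] at h
  rcases h.1 with h | h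
  · exact absurd (hM.2 _ h.1) (not_isBlue_of_ne huv i j)
  · exact h.1

/-- The two white edges replacing `uv` lie on a common cycle iff the two vertices of the
hexagon of `u` that they cover do. -/
theorem exists_edgeInComp_whitePairs_iff (hM : IsBluePM G idx M) {u v : V} (h : G.Adj u v) :
    (∃ c : (sdGraph G idx M).ConnectedComponent,
        edgeInComp (sdGraph G idx M) (whitePairs idx u v).1 c ∧
        edgeInComp (sdGraph G idx M) (whitePairs idx u v).2 c) ↔
      (sdGraph G idx M).Reachable (u, idx u v) (u, idx u v + 3) := by
  obtain ⟨j, hj⟩ := whitePairs_eq idx u v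
  have h₁ : (sdGraph G idx M).Adj (u, idx u v) (v, j) :=
    sdGraph_adj_of_isWhite hM h.ne ⟨u, v, h, Or.inl (by rw [hj])⟩
  have h₂ : (sdGraph G idx M).Adj (u, idx u v + 3) (v, j + 3) :=
    sdGraph_adj_of_isWhite hM h.ne ⟨u, v, h, Or.inr (by rw [hj])⟩
  rw [hj]
  constructor
  · rintro ⟨c, hc₁, hc₂⟩
    exact ConnectedComponent.exact
      ((hc₁.2 _ (Sym2.mem_mk_left _ _)).trans (hc₂.2 _ (Sym2.mem_mk_left _ _)).symm)
  · intro hr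
    refine ⟨(sdGraph G idx M).connectedComponentMk (u, idx u v), ⟨h₁, ?_⟩, ⟨h₂, ?_⟩⟩
    · intro x hx
      rcases Sym2.mem_iff.1 hx with rfl | rfl
      · rfl
      · exact ConnectedComponent.sound h₁.symm.reachable
    · intro x hx
      rcases Sym2.mem_iff.1 hx with rfl | rfl
      · exact ConnectedComponent.sound hr.symm
      · exact ConnectedComponent.sound (h₂.symm.reachable.trans hr.symm)

/-- The edge `uv` is induced exactly by the cycles through the two vertices of the hexagon
of `u` covered by the white edges replacing `uv`. -/
theorem mem_inducedSet_iff (hM : IsBluePM G idx M) {u v : V} (h : G.Adj u v)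
    (c : (sdGraph G idx M).ConnectedComponent) :
    s(u, v) ∈ inducedSet G idx M c ↔
      c = (sdGraph G idx M).connectedComponentMk (u, idx u v) ∨
      c = (sdGraph G idx M).connectedComponentMk (u, idx u v + 3) := by
  obtain ⟨j, hj⟩ := whitePairs_eq idx u v
  have h₁ : (sdGraph G idx M).Adj (u, idx u v) (v, j) :=
    sdGraph_adj_of_isWhite hM h.ne ⟨u, v, h, Or.inl (by rw [hj])⟩
  have h₂ : (sdGraph G idx M).Adj (u, idx u v + 3) (v, j + 3) :=
    sdGraph_adj_of_isWhite hM h.ne ⟨u, v, h, Or.inr (by rw [hj])⟩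
  constructor
  · rintro ⟨a, b, i, k, hadj, hab, rfl, he⟩
    obtain ⟨p, q, -, hpq⟩ := isWhite_of_sdGraph_adj hM hab hadj
    have hs : s(p, q) = s(a, b) := by
      obtain ⟨l, hl⟩ := whitePairs_eq idx p q
      rw [hl] at hpq
      rcases hpq with hpq | hpq <;> exact (congrArg (Sym2.map Prod.fst) hpq).symm
    have huv : s((a, i), (b, k)) = (whitePairs idx u v).1 ∨
        s((a, i), (b, k)) = (whitePairs idx u v).2 := by
      rcases Sym2.eq_iff.1 (hs.trans he.symm) with ⟨rfl, rfl⟩ | ⟨rfl, rfl⟩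
      · exact hpq
      · rcases whitePairs_comm idx q p with hc | hc
        · rwa [hc] at hpq
        · rw [hc] at hpq
          exact hpq.symm
    rw [hj] at huv
    rcases huv with huv | huv
    · left
      rcases Sym2.eq_iff.1 huv with ⟨h₃, -⟩ | ⟨h₃, -⟩
      · rw [h₃]
      · rw [h₃]
        exact ConnectedComponent.sound h₁.symm.reachable
    · right
      rcases Sym2.eq_iff.1 huv with ⟨h₃, -⟩ | ⟨h₃, -⟩
      · rw [h₃]
      · rw [h₃]
        exact ConnectedComponent.sound h₂.symm.reachable
  · rintro (rfl | rfl)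
    · exact ⟨u, v, _, _, h₁, h.ne, rfl, rfl⟩
    · exact ⟨u, v, _, _, h₂, h.ne, rfl, rfl⟩

theorem existsUnique_inducedSet_iff (hM : IsBluePM G idx M) {u v : V} (h : G.Adj u v) :
    (∃! c : (sdGraph G idx M).ConnectedComponent, s(u, v) ∈ inducedSet G idx M c) ↔
      (sdGraph G idx M).Reachable (u, idx u v) (u, idx u v + 3) := by
  simp only [mem_inducedSet_iff hM h]
  constructor
  · intro hc
    exact ConnectedComponent.exact (hc.unique (Or.inl rfl) (Or.inr rfl))
  · intro hr
    refine ⟨_, Or.inl rfl, ?_⟩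
    rintro c (rfl | rfl)
    · rfl
    · exact ConnectedComponent.sound hr.symm

theorem exists_adj_idx_eq (hG : IsCubic G) (hidx : GoodIdx G idx) (v : V) {i : ZMod 6}
    (hi : i.val < 3) : ∃ u, G.Adj v u ∧ idx v u = i := by
  have hinj : Set.InjOn (idx v) (G.neighborSet v) := fun u hu w hw he => by
    by_contra hne
    exact hidx.2 v u w hu hw hne he
  have hcard : {x : ZMod 6 | x.val < 3}.ncard = 3 := by
    rw [Set.ncard_eq_toFinset_card']
    decide
  have himage : idx v '' G.neighborSet v = {x : ZMod 6 | x.val < 3} := by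
    refine Set.eq_of_subset_of_ncard_le ?_ ?_ (Set.toFinite _)
    · rintro _ ⟨u, hu, rfl⟩
      exact hidx.1 v u hu
    · rw [hcard, hinj.ncard_image, hG v]
  have hmem : i ∈ idx v '' G.neighborSet v := by rwa [himage]
  exact hmem

/-- Every red edge of the hexagon of `v` is covered by the white edges replacing some edge
of `G` incident with `v`. -/
theorem exists_reachable_red_iff (hG : IsCubic G) (hidx : GoodIdx G idx) :
    (∃ (v : V) (i : ZMod 6), (sdGraph G idx M).Reachable (v, i) (v, i + 3)) ↔
      ∃ u v : V, G.Adj u v ∧ (sdGraph G idx M).Reachable (u, idx u v) (u, idx u v + 3) := by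
  constructor
  · rintro ⟨v, i, hr⟩
    have hi : i.val < 3 ∨ (i + 3).val < 3 := by
      clear hr
      revert i
      decide
    rcases hi with hi | hi
    · obtain ⟨u, hu, rfl⟩ := exists_adj_idx_eq hG hidx v hi
      exact ⟨v, u, hu, hr⟩
    · obtain ⟨u, hu, he⟩ := exists_adj_idx_eq hG hidx v hi
      refine ⟨v, u, hu, ?_⟩
      rw [he, add_assoc, show (3 + 3 : ZMod 6) = 0 by decide, add_zero]
      exact hr.symm
  · rintro ⟨u, v, -, hr⟩
    exact ⟨u, _, hr⟩

end

/-- some cycle of `M Δ W` contains both ends of a red edge iff the two white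
edges `e_{uv}`, `e'_{uv}` of some edge `uv` of `G` lie on a common cycle of `M Δ W`, iff
some edge of `G` belongs to the subgraph induced by exactly one cycle of `M Δ W`. -/
theorem stmt7 {V : Type} [Fintype V] [DecidableEq V] (G : SimpleGraph V)
    (hG : IsCubic G) (idx : V → V → ZMod 6) (hidx : GoodIdx G idx)
    (M : (hexagonGraph G idx).Subgraph) (hM : IsBluePM G idx M) :
    ((∃ (v : V) (i : ZMod 6), (sdGraph G idx M).Reachable (v, i) (v, i + 3)) ↔
      (∃ u v : V, G.Adj u v ∧ ∃ c : (sdGraph G idx M).ConnectedComponent,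
        edgeInComp (sdGraph G idx M) (whitePairs idx u v).1 c ∧
        edgeInComp (sdGraph G idx M) (whitePairs idx u v).2 c)) ∧
    ((∃ u v : V, G.Adj u v ∧ ∃ c : (sdGraph G idx M).ConnectedComponent,
        edgeInComp (sdGraph G idx M) (whitePairs idx u v).1 c ∧
        edgeInComp (sdGraph G idx M) (whitePairs idx u v).2 c) ↔
      (∃ e ∈ G.edgeSet, ∃! c : (sdGraph G idx M).ConnectedComponent,
        e ∈ inducedSet G idx M c)) := by
  have hpair : (∃ u v : V, G.Adj u v ∧ ∃ c : (sdGraph G idx M).ConnectedComponent,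
        edgeInComp (sdGraph G idx M) (whitePairs idx u v).1 c ∧
        edgeInComp (sdGraph G idx M) (whitePairs idx u v).2 c) ↔
      ∃ u v : V, G.Adj u v ∧ (sdGraph G idx M).Reachable (u, idx u v) (u, idx u v + 3) :=
    exists_congr fun _ => exists_congr fun _ =>
      and_congr_right fun h => exists_edgeInComp_whitePairs_iff hM h
  refine ⟨(exists_reachable_red_iff hG hidx).trans hpair.symm, hpair.trans ⟨?_, ?_⟩⟩
  · rintro ⟨u, v, h, hr⟩
    exact ⟨s(u, v), h, (existsUnique_inducedSet_iff hM h).2 hr⟩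
  · rintro ⟨e, he, hc⟩
    induction e with
    | h u v => exact ⟨u, v, he, (existsUnique_inducedSet_iff hM he).1 hc⟩

end Hex
end
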